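/- A linear map ζ : ℝ³ → skew(3) satisfies ζ(qx) = q ζ(x) qᵀ for all q ∈ SO(3) and x ∈ ℝ³ if and only if there exists a constant c ∈ ℝ such that ζ(x) = c·A_x for all x, where A_x is the cross-product matrix of x, i.e. the unique skew-symmetric 3×3 matrix with A_x y = x × y for all y ∈ ℝ³. -/

import Mathlib

open Matrix

/-- The space `skew(n)` of skew-symmetric real `n × n` matrices. -/
def Skew (n : ℕ) : Submodule ℝ (Matrix (Fin n) (Fin n) ℝ) where
  carrier := {A | Aᵀ = -A}
  add_mem' := by
    intro a b ha hb
    simp only [Set.mem_setOf_eq] at *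
    rw [Matrix.transpose_add, ha, hb, neg_add]
  zero_mem' := by simp
  smul_mem' := by
    intro c A hA
    simp only [Set.mem_setOf_eq] at *
    rw [Matrix.transpose_smul, hA, smul_neg]

lemma conj_mem {n : ℕ} (q : Matrix (Fin n) (Fin n) ℝ) {A : Matrix (Fin n) (Fin n) ℝ}
    (hA : A ∈ Skew n) : q * A * qᵀ ∈ Skew n := by
  have h : Aᵀ = -A := hA
  show (q * A * qᵀ)ᵀ = -(q * A * qᵀ)
  rw [Matrix.transpose_mul, Matrix.transpose_mul, Matrix.transpose_transpose, h]
  simp [Matrix.mul_assoc]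

/-- Conjugation `A ↦ q A qᵀ` on skew-symmetric matrices. -/
def conjS {n : ℕ} (q : Matrix (Fin n) (Fin n) ℝ) (A : Skew n) : Skew n :=
  ⟨q * A.val * qᵀ, conj_mem q A.2⟩

/-- `x ∧ y := y xᵀ − x yᵀ`. -/
def wedge {n : ℕ} (x y : Fin n → ℝ) : Matrix (Fin n) (Fin n) ℝ :=
  Matrix.vecMulVec y x - Matrix.vecMulVec x y

lemma wedge_mem {n : ℕ} (x y : Fin n → ℝ) : wedge x y ∈ Skew n := by
  show (wedge x y)ᵀ = -(wedge x y)
  ext i j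
  simp [wedge, Matrix.vecMulVec_apply, Matrix.transpose_apply, Matrix.sub_apply, Matrix.neg_apply]
  ring

/-- `x ∧ y` as an element of `skew(n)`. -/
def wedgeS {n : ℕ} (x y : Fin n → ℝ) : Skew n := ⟨wedge x y, wedge_mem x y⟩

lemma comm_mem {n : ℕ} {A B : Matrix (Fin n) (Fin n) ℝ} (hA : A ∈ Skew n) (hB : B ∈ Skew n) :
    A * B - B * A ∈ Skew n := by
  have hA' : Aᵀ = -A := hA
  have hB' : Bᵀ = -B := hB
  show (A * B - B * A)ᵀ = -(A * B - B * A)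
  rw [Matrix.transpose_sub, Matrix.transpose_mul, Matrix.transpose_mul, hA', hB']
  simp [neg_sub]

/-- The commutator `AB − BA` as an element of `skew(n)`. -/
def commS {n : ℕ} (A B : Skew n) : Skew n :=
  ⟨A.val * B.val - B.val * A.val, comm_mem A.2 B.2⟩

/-- The cofactor matrix of `M` carries `x × y` to `Mx × My`. -/
lemma crossProduct_mulVec_mulVec {R : Type*} [CommRing R] (M : Matrix (Fin 3) (Fin 3) R)
    (x y : Fin 3 → R) :
    crossProduct (M *ᵥ x) (M *ᵥ y) = M.adjugateᵀ *ᵥ crossProduct x y := by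
  ext i
  fin_cases i <;>
    simp [cross_apply, Matrix.mulVec, dotProduct, Fin.sum_univ_three, Matrix.adjugate_fin_three] <;>
    ring

/-- Rotations preserve the cross product. -/
lemma mulVec_crossProduct {R : Type*} [CommRing R] {q : Matrix (Fin 3) (Fin 3) R}
    (hq : qᵀ * q = 1) (hdet : q.det = 1) (x y : Fin 3 → R) :
    q *ᵥ crossProduct x y = crossProduct (q *ᵥ x) (q *ᵥ y) := by
  have hadj : q.adjugate = qᵀ := by
    calc q.adjugate = (qᵀ * q) * q.adjugate := by rw [hq, Matrix.one_mul]
      _ = qᵀ := by rw [Matrix.mul_assoc, Matrix.mul_adjugate, hdet, one_smul, Matrix.mul_one]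
  rw [crossProduct_mulVec_mulVec, hadj, Matrix.transpose_transpose]

/-- The entries of a skew-symmetric matrix are antisymmetric in their indices. -/
lemma Skew.apply_swap {n : ℕ} (A : Skew n) (i j : Fin n) : A.val i j = -A.val j i :=
  congrFun (congrFun (show A.valᵀ = -A.val from A.2) j) i

/-- A linear map `ζ : ℝ³ → skew(3)` is `SO(3)`-equivariant if and only if there is a
constant `c` such that `ζ(x)` is `c` times the cross-product matrix of `x`, i.e.
`ζ(x) y = c (x × y)` for all `y`. -/
theorem so3_equivariant_map_iff_cross (ζ : (Fin 3 → ℝ) →ₗ[ℝ] Skew 3) :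
    (∀ q : Matrix (Fin 3) (Fin 3) ℝ, qᵀ * q = 1 → q.det = 1 →
        ∀ x : Fin 3 → ℝ, ζ (q.mulVec x) = conjS q (ζ x))
    ↔ ∃ c : ℝ, ∀ x y : Fin 3 → ℝ, (ζ x).val.mulVec y = c • (crossProduct x y) := by
  constructor
  · intro h
    have apply_of_rotation (q : Matrix (Fin 3) (Fin 3) ℝ) (hq : qᵀ * q = 1) (hdet : q.det = 1)
        ⦃x y : Fin 3 → ℝ⦄ (hxy : q *ᵥ x = y) (i j : Fin 3) :
        (ζ y).val i j = ∑ l, (∑ k, q i k * (ζ x).val k l) * q j l := by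
      rw [← hxy, h q hq hdet x]
      simp only [conjS, Matrix.mul_apply, Matrix.transpose_apply]
    have half_turn := apply_of_rotation !![1, 0, 0; 0, -1, 0; 0, 0, -1]
      (by ext i j; fin_cases i <;> fin_cases j <;> simp [Matrix.mul_apply, Fin.sum_univ_three])
      (by simp [Matrix.det_fin_three])
      (show _ *ᵥ ![1, 0, 0] = ![1, 0, 0] by ext i; fin_cases i <;> simp)
    have cyclic := apply_of_rotation !![0, 0, 1; 1, 0, 0; 0, 1, 0]
      (by ext i j; fin_cases i <;> fin_cases j <;> simp [Matrix.mul_apply, Fin.sum_univ_three])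
      (by simp [Matrix.det_fin_three])
    have cyclic₀ := cyclic (show _ *ᵥ ![1, 0, 0] = ![0, 1, 0] by ext i; fin_cases i <;> simp)
    have cyclic₁ := cyclic (show _ *ᵥ ![0, 1, 0] = ![0, 0, 1] by ext i; fin_cases i <;> simp)
    have skew := Skew.apply_swap (ζ ![1, 0, 0])
    simp [Fin.forall_fin_succ, Fin.sum_univ_three] at half_turn cyclic₀ cyclic₁ skew
    refine ⟨(ζ ![1, 0, 0]).val 2 1, fun x y => ?_⟩
    have decomposition : ζ x = x 0 • ζ ![1, 0, 0] + x 1 • ζ ![0, 1, 0] + x 2 • ζ ![0, 0, 1] := by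
      rw [← map_smul, ← map_smul, ← map_smul, ← map_add, ← map_add]
      congr 1
      ext i
      fin_cases i <;> simp
    rw [decomposition]
    ext i
    fin_cases i <;> simp [Matrix.mulVec, dotProduct, Fin.sum_univ_three, cross_apply] <;> grind
  · rintro ⟨c, hc⟩ q hq hdet x
    have hq' : q * qᵀ = 1 := mul_eq_one_comm.mp hq
    refine Subtype.ext (Matrix.mulVec_injective (funext fun y => ?_))
    calc (ζ (q *ᵥ x)).val *ᵥ y = c • crossProduct (q *ᵥ x) (q *ᵥ (qᵀ *ᵥ y)) := by
          rw [hc, Matrix.mulVec_mulVec, hq', Matrix.one_mulVec]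
      _ = q *ᵥ ((ζ x).val *ᵥ (qᵀ *ᵥ y)) := by
          rw [hc, Matrix.mulVec_smul, mulVec_crossProduct hq hdet]
      _ = (conjS q (ζ x)).val *ᵥ y := by
          simp only [conjS, Matrix.mulVec_mulVec, Matrix.mul_assoc]
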